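/- arXiv:1311.3641 — 7 statements merged into one kernel-verified Lean document; each statement's English description precedes it below -/
import Mathlib

section
/- Relative Poincaré lemma for 1-forms vanishing to second order on the Martinet line: let P and Q be functions analytic on a neighborhood of 0 ∈ ℂ² such that P is divisible by x, Q is divisible by x², and ∂P/∂y = ∂Q/∂x (i.e. the 1-form P dx + Q dy is closed). Then there exists a function g, analytic on a possibly smaller neighborhood of 0 and divisible by x², with ∂g/∂x = P and ∂g/∂y = Q. -/
open Filter Topology

/-- The partial derivative with respect to the first variable. -/
noncomputable def pdx (f : ℂ × ℂ → ℂ) (z : ℂ × ℂ) : ℂ := fderiv ℂ f z (1, 0)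

/-- The partial derivative with respect to the second variable. -/
noncomputable def pdy (f : ℂ × ℂ → ℂ) (z : ℂ × ℂ) : ℂ := fderiv ℂ f z (0, 1)

/-- A function germ at `0 ∈ ℂ²` is divisible by `x`: it equals `x · a` near `0`
for some analytic `a`. -/
def DivX (P : ℂ × ℂ → ℂ) : Prop :=
  ∃ a : ℂ × ℂ → ℂ, AnalyticAt ℂ a 0 ∧ ∀ᶠ z in 𝓝 (0 : ℂ × ℂ), P z = z.1 * a z

/-- A function germ at `0 ∈ ℂ²` is divisible by `x²`. -/
def DivX2 (P : ℂ × ℂ → ℂ) : Prop :=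
  ∃ a : ℂ × ℂ → ℂ, AnalyticAt ℂ a 0 ∧ ∀ᶠ z in 𝓝 (0 : ℂ × ℂ), P z = z.1 ^ 2 * a z

/-- A differentiable germ `θ` with `Dθ(z) z + θ(z) = 0` vanishes, because `t ↦ t • θ (t • z)` is
constant. -/
theorem eventually_eq_zero_of_fderiv_self_add_eq_zero {E F : Type*}
    [NormedAddCommGroup E] [NormedSpace ℝ E] [NormedAddCommGroup F] [NormedSpace ℝ F]
    {θ : E → F}
    (h : ∀ᶠ z in 𝓝 (0 : E), ∃ L : E →L[ℝ] F, HasFDerivAt θ L z ∧ L z + θ z = 0) :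
    ∀ᶠ z in 𝓝 (0 : E), θ z = 0 := by
  obtain ⟨r, hr, hball⟩ := Metric.eventually_nhds_iff_ball.1 h
  filter_upwards [Metric.ball_mem_nhds (0 : E) hr] with z hz
  have hderiv : ∀ t ∈ Set.Icc (0 : ℝ) 1, HasDerivAt (fun t : ℝ => t • θ (t • z)) 0 t := by
    intro t ht
    have hmem : t • z ∈ Metric.ball (0 : E) r := by
      rw [mem_ball_zero_iff] at hz ⊢
      rw [norm_smul, Real.norm_of_nonneg ht.1]
      exact (mul_le_of_le_one_left (norm_nonneg z) ht.2).trans_lt hz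
    obtain ⟨L, hL, hL0⟩ := hball _ hmem
    have hline : HasDerivAt (fun t : ℝ => t • z) z t := by
      simpa using (hasDerivAt_id t).smul_const z
    have := (hasDerivAt_id t).smul (hL.comp_hasDerivAt t hline)
    refine this.congr_deriv ?_
    simpa using hL0
  have hconst := constant_of_has_deriv_right_zero
    (fun t ht => (hderiv t ht).continuousAt.continuousWithinAt)
    (fun t ht => (hderiv t (Set.Ico_subset_Icc_self ht)).hasDerivWithinAt) 1
    (Set.right_mem_Icc.2 zero_le_one)
  simpa using hconst

/-- The equation `DA(z) z + k A(z) = a(z)` has an analytic solution near `0` for every analytic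
`a` and every `k > 0`. -/
theorem AnalyticAt.exists_fderiv_self_add_mul_eq {E : Type*} [NormedAddCommGroup E]
    [NormedSpace ℂ E] {a : E → ℂ} (ha : AnalyticAt ℂ a 0) {k : ℕ} (hk : 0 < k) :
    ∃ A : E → ℂ, AnalyticAt ℂ A 0 ∧
      ∀ᶠ z in 𝓝 (0 : E), fderiv ℂ A z z + k * A z = a z := by
  obtain ⟨p, r, hp⟩ := ha
  let c : ℕ → ℂ := fun n => ((n + k : ℕ) : ℂ)⁻¹
  let q : FormalMultilinearSeries ℂ E ℂ := fun n => c n • p n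
  have hc : ∀ n, ‖c n‖ ≤ 1 := fun n => by
    simp only [c, norm_inv, Complex.norm_natCast]
    exact inv_le_one_of_one_le₀ (by exact_mod_cast (by omega : 1 ≤ n + k))
  have hrad : p.radius ≤ q.radius :=
    FormalMultilinearSeries.radius_le_of_le fun {n} => by
      rw [norm_smul]
      exact mul_le_of_le_one_left (norm_nonneg _) (hc n)
  have hq : HasFPowerSeriesOnBall q.sum q 0 r :=
    (q.hasFPowerSeriesOnBall (hp.r_pos.trans_le (hp.r_le.trans hrad))).mono hp.r_pos
      (hp.r_le.trans hrad)
  refine ⟨q.sum, hq.analyticAt, ?_⟩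
  filter_upwards [Metric.eball_mem_nhds (0 : E) hp.r_pos] with z hz
  have hsum := hq.hasSum hz
  have hpsum := hp.hasSum hz
  have hdsum := (ContinuousLinearMap.apply ℂ ℂ z).hasSum (hq.fderiv.hasSum hz)
  simp only [zero_add, ContinuousLinearMap.apply_apply,
    FormalMultilinearSeries.derivSeries_apply_diag] at hsum hpsum hdsum
  have hdsum' : HasSum (fun n : ℕ => (n : ℂ) * q n fun _ => z) (fderiv ℂ q.sum z z) := by
    refine (hasSum_nat_add_iff' 1).1 ?_
    simpa using hdsum
  have hterm : ∀ n : ℕ, (n : ℂ) * (q n fun _ => z) + k * (q n fun _ => z) = p n fun _ => z := by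
    intro n
    have hne : (n : ℂ) + k ≠ 0 := by exact_mod_cast (by omega : n + k ≠ 0)
    have hqn : (q n fun _ => z) = ((n + k : ℕ) : ℂ)⁻¹ * p n fun _ => z := rfl
    rw [hqn]
    push_cast
    field_simp
  have hadd := hdsum'.add (hsum.mul_left (k : ℂ))
  simp only [hterm] at hadd
  exact hadd.unique hpsum

/-- A closed analytic 1-form `ω` is the differential of every analytic `g` satisfying
`Dg(z) z = ω(z) z`. -/
theorem eventually_fderiv_eq_of_fderiv_self_eq {E : Type*} [NormedAddCommGroup E]
    [NormedSpace ℂ E] {ω : E → E →L[ℂ] ℂ} {g : E → ℂ}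
    (hω : AnalyticAt ℂ ω 0) (hg : AnalyticAt ℂ g 0)
    (hclosed : ∀ᶠ z in 𝓝 (0 : E), ∀ v w, fderiv ℂ ω z v w = fderiv ℂ ω z w v)
    (hself : ∀ᶠ z in 𝓝 (0 : E), fderiv ℂ g z z = ω z z) :
    ∀ᶠ z in 𝓝 (0 : E), fderiv ℂ g z = ω z := by
  suffices h : ∀ᶠ z in 𝓝 (0 : E), (fderiv ℂ g - ω) z = 0 by
    filter_upwards [h] with z hz using sub_eq_zero.1 hz
  apply eventually_eq_zero_of_fderiv_self_add_eq_zero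
  filter_upwards [hω.eventually_analyticAt, hg.eventually_analyticAt, hclosed,
    hself.eventually_nhds] with z hωz hgz hcz hsz
  have hd := hgz.fderiv.differentiableAt.hasFDerivAt.sub hωz.differentiableAt.hasFDerivAt
  refine ⟨_, hd.restrictScalars ℝ, ?_⟩
  have hzero : (fun w => (fderiv ℂ g - ω) w w) =ᶠ[𝓝 z] fun _ => 0 := by
    filter_upwards [hsz] with w hw
    simp [hw]
  have happ := (hd.clm_apply (hasFDerivAt_id z)).unique
    ((hasFDerivAt_const (0 : ℂ) z).congr_of_eventuallyEq hzero)
  have hsymm : IsSymmSndFDerivAt ℂ g z := hgz.contDiffAt.isSymmSndFDerivAt_of_omega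
  ext v
  have hv := DFunLike.congr_fun happ v
  simp only [id, add_apply, ContinuousLinearMap.comp_apply,
    ContinuousLinearMap.flip_apply, sub_apply, Pi.sub_apply,
    ContinuousLinearMap.coe_restrictScalars', zero_apply,
    ContinuousLinearMap.id_apply, hcz v z, hsymm v z] at hv ⊢
  linear_combination hv

/-- Relative Poincaré lemma for closed 1-forms `P dx + Q dy` in `x Ω¹_H`
(`x ∣ P`, `x² ∣ Q`): such a form is `dg` for some `g` divisible by `x²`. -/
theorem relative_poincare_one_forms (P Q : ℂ × ℂ → ℂ)
    (hP : AnalyticAt ℂ P 0) (hQ : AnalyticAt ℂ Q 0)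
    (hPx : DivX P) (hQx : DivX2 Q)
    (hclosed : ∀ᶠ z in 𝓝 (0 : ℂ × ℂ), pdy P z = pdx Q z) :
    ∃ g : ℂ × ℂ → ℂ, AnalyticAt ℂ g 0 ∧ DivX2 g ∧
      ∀ᶠ z in 𝓝 (0 : ℂ × ℂ), pdx g z = P z ∧ pdy g z = Q z := by
  obtain ⟨a, ha, hPa⟩ := hPx
  obtain ⟨b, hb, hQb⟩ := hQx
  obtain ⟨A, hA, hAa⟩ := ha.exists_fderiv_self_add_mul_eq two_pos
  obtain ⟨B, hB, hBb⟩ := hb.exists_fderiv_self_add_mul_eq three_pos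
  have hG : AnalyticAt ℂ (fun z : ℂ × ℂ => A z + z.2 * B z) 0 := hA.add (analyticAt_snd.mul hB)
  have hg : AnalyticAt ℂ (fun z : ℂ × ℂ => z.1 ^ 2 * (A z + z.2 * B z)) 0 :=
    (analyticAt_fst.pow 2).mul hG
  let dx := ContinuousLinearMap.fst ℂ ℂ ℂ
  let dy := ContinuousLinearMap.snd ℂ ℂ ℂ
  have hω : AnalyticAt ℂ (fun z => P z • dx + Q z • dy) 0 :=
    (hP.smul analyticAt_const).add (hQ.smul analyticAt_const)
  refine ⟨_, hg, ⟨_, hG, .of_forall fun _ => rfl⟩, ?_⟩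
  have hfderiv := eventually_fderiv_eq_of_fderiv_self_eq hω hg ?_ ?_
  · filter_upwards [hfderiv] with z hz
    simp [pdx, pdy, hz, dx, dy]
  · filter_upwards [hP.eventually_analyticAt, hQ.eventually_analyticAt, hclosed]
      with z hPz hQz hcz v w
    have hd : HasFDerivAt (fun z => P z • dx + Q z • dy) _ z := (hPz.differentiableAt.hasFDerivAt.smul_const dx).add
      (hQz.differentiableAt.hasFDerivAt.smul_const dy)
    have hcoord : ∀ (L : ℂ × ℂ →L[ℂ] ℂ) (u : ℂ × ℂ), L u = u.1 * L (1, 0) + u.2 * L (0, 1) := by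
      intro L u
      rw [← smul_eq_mul, ← smul_eq_mul, ← map_smul, ← map_smul, ← map_add]
      simp
    rw [hd.fderiv]
    simp only [pdx, pdy] at hcz
    simp only [dx, dy, add_apply, ContinuousLinearMap.smulRight_apply,
      smul_apply, ContinuousLinearMap.coe_fst', ContinuousLinearMap.coe_snd',
      smul_eq_mul]
    rw [hcoord (fderiv ℂ P z) v, hcoord (fderiv ℂ P z) w, hcoord (fderiv ℂ Q z) v,
      hcoord (fderiv ℂ Q z) w, hcz]
    ring
  · filter_upwards [hPa, hQb, hAa, hBb, hA.eventually_analyticAt, hB.eventually_analyticAt]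
      with z hPz hQz hAz hBz hA' hB'
    have hd := (((hasFDerivAt_fst (𝕜 := ℂ) (p := z)).pow 2).mul
      (hA'.differentiableAt.hasFDerivAt.add
        ((hasFDerivAt_snd (𝕜 := ℂ) (p := z)).mul hB'.differentiableAt.hasFDerivAt)))
    have hdz := congrArg (fun L => L z) hd.fderiv
    refine hdz.trans ?_
    simp [dx, dy, hPz, hQz]
    push_cast at hAz hBz
    rw [← hAz, ← hBz]
    ring
end

section
/- Absence of nonzero closed relative forms (the Remark after Lemma 2): let f be analytic near 0 ∈ ℂ² whose gradient (f_x, f_y) is nonzero at every point z ≠ 0 of some punctured neighborhood of 0, and suppose the one-variable function y ↦ f(0,y) is not constant near 0. If h is analytic near 0 with f_x·h_y − f_y·h_x = 0 near 0 (i.e. df ∧ dh = 0) and h(0,y) = 0 for all small y (h vanishes on the line {x = 0}), then h vanishes identically on a neighborhood of 0. -/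
open Filter Topology

/-- The differential of a function on `ℂ²` in terms of its two partial derivatives. -/
theorem fderiv_apply_eq_pdx_add_pdy (f : ℂ × ℂ → ℂ) (z v : ℂ × ℂ) :
    fderiv ℂ f z v = v.1 * pdx f z + v.2 * pdy f z := by
  have hv : v = v.1 • ((1 : ℂ), (0 : ℂ)) + v.2 • ((0 : ℂ), (1 : ℂ)) := by
    ext <;> simp
  conv_lhs => rw [hv]
  rw [map_add, map_smul, map_smul, smul_eq_mul, smul_eq_mul, pdx, pdy]

theorem hasDerivAt_snd_of_differentiableAt {f : ℂ × ℂ → ℂ} {x y : ℂ}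
    (hf : DifferentiableAt ℂ f (x, y)) :
    HasDerivAt (fun t => f (x, t)) (pdy f (x, y)) y :=
  hf.hasFDerivAt.comp_hasDerivAt y ((hasDerivAt_const y x).prodMk (hasDerivAt_id y))

theorem hasDerivAt_fst_of_differentiableAt {f : ℂ × ℂ → ℂ} {x y : ℂ}
    (hf : DifferentiableAt ℂ f (x, y)) :
    HasDerivAt (fun t => f (t, y)) (pdx f (x, y)) x :=
  hf.hasFDerivAt.comp_hasDerivAt x ((hasDerivAt_id x).prodMk (hasDerivAt_const x y))

/-- The continuous linear automorphism `(x, y) ↦ (x, a x + b y)` of `ℂ²`, for `b ≠ 0`. -/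
noncomputable def shearEquiv (a b : ℂ) (hb : b ≠ 0) : (ℂ × ℂ) ≃L[ℂ] (ℂ × ℂ) :=
  ContinuousLinearEquiv.equivOfInverse
    ((ContinuousLinearMap.fst ℂ ℂ ℂ).prod
      (a • ContinuousLinearMap.fst ℂ ℂ ℂ + b • ContinuousLinearMap.snd ℂ ℂ ℂ))
    ((ContinuousLinearMap.fst ℂ ℂ ℂ).prod
      (b⁻¹ • (ContinuousLinearMap.snd ℂ ℂ ℂ - a • ContinuousLinearMap.fst ℂ ℂ ℂ)))
    (fun v => by ext <;> simp [hb])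
    (fun v => by ext <;> simp [hb])

/-- Where `f_y ≠ 0`, the pair `(x, f)` is a local analytic coordinate system. -/
theorem exists_local_inverse_fst_prod {f : ℂ × ℂ → ℂ} {p : ℂ × ℂ} (hf : AnalyticAt ℂ f p)
    (hfy : pdy f p ≠ 0) :
    ∃ Ψ : ℂ × ℂ → ℂ × ℂ, AnalyticAt ℂ Ψ (p.1, f p) ∧ Ψ (p.1, f p) = p ∧
      (∀ᶠ q in 𝓝 (p.1, f p), (Ψ q).1 = q.1 ∧ f (Ψ q) = q.2) ∧
      ∀ᶠ z in 𝓝 p, Ψ (z.1, f z) = z := by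
  have hΦ : ContDiffAt ℂ ⊤ (fun z : ℂ × ℂ => (z.1, f z)) p :=
    (analyticAt_fst.prod hf).contDiffAt
  have hd : HasFDerivAt (fun z : ℂ × ℂ => (z.1, f z))
      (shearEquiv (pdx f p) (pdy f p) hfy : ℂ × ℂ →L[ℂ] ℂ × ℂ) p := by
    refine (hasFDerivAt_fst.prodMk hf.differentiableAt.hasFDerivAt).congr_fderiv ?_
    refine ContinuousLinearMap.ext fun v => ?_
    refine Prod.ext rfl ?_
    change fderiv ℂ f p v = pdx f p * v.1 + pdy f p * v.2
    rw [fderiv_apply_eq_pdx_add_pdy]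
    ring
  have hs := hΦ.hasStrictFDerivAt' hd (by simp)
  refine ⟨hΦ.localInverse hd (by simp), (hΦ.to_localInverse hd (by simp)).analyticAt,
    hΦ.localInverse_apply_image hd (by simp), ?_, hs.eventually_left_inverse⟩
  filter_upwards [hs.eventually_right_inverse] with q hq
  exact Prod.ext_iff.mp hq

/-- If `df ∧ dh = 0`, then `h` does not depend on `x` in the coordinates `(x, f)`. -/
theorem pdx_comp_eq_zero_of_wedge_eq_zero {f h : ℂ × ℂ → ℂ} {Ψ : ℂ × ℂ → ℂ × ℂ} {q : ℂ × ℂ}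
    (hΨ : DifferentiableAt ℂ Ψ q) (hf : DifferentiableAt ℂ f (Ψ q))
    (hh : DifferentiableAt ℂ h (Ψ q)) (hfy : pdy f (Ψ q) ≠ 0)
    (hwedge : pdx f (Ψ q) * pdy h (Ψ q) - pdy f (Ψ q) * pdx h (Ψ q) = 0)
    (hinv : ∀ᶠ w in 𝓝 q, (Ψ w).1 = w.1 ∧ f (Ψ w) = w.2) :
    pdx (h ∘ Ψ) q = 0 := by
  set v := fderiv ℂ Ψ q (1, 0) with hv
  have h1 : v.1 = 1 := by
    have e : (fun w => (Ψ w).1) =ᶠ[𝓝 q] Prod.fst := hinv.mono fun w hw => hw.1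
    have := (hΨ.hasFDerivAt.fst.congr_of_eventuallyEq e.symm).unique hasFDerivAt_fst
    exact congrArg (fun L : ℂ × ℂ →L[ℂ] ℂ => L (1, 0)) this
  have h2 : fderiv ℂ f (Ψ q) v = 0 := by
    have e : f ∘ Ψ =ᶠ[𝓝 q] Prod.snd := hinv.mono fun w hw => hw.2
    have := ((hf.hasFDerivAt.comp q hΨ.hasFDerivAt).congr_of_eventuallyEq e.symm).unique
      hasFDerivAt_snd
    exact congrArg (fun L : ℂ × ℂ →L[ℂ] ℂ => L (1, 0)) this
  have h3 : pdx (h ∘ Ψ) q = fderiv ℂ h (Ψ q) v := by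
    rw [pdx, fderiv_comp q hh hΨ]
    rfl
  rw [fderiv_apply_eq_pdx_add_pdy, h1] at h2
  rw [h3, fderiv_apply_eq_pdx_add_pdy, h1]
  refine (mul_eq_zero.mp ?_).resolve_left hfy
  linear_combination pdy h (Ψ q) * h2 - hwedge

/-- A function near `(0, c)` with vanishing `x`-derivative that vanishes on `{x = 0}` is zero. -/
theorem eventually_eq_zero_of_pdx_eq_zero {g : ℂ × ℂ → ℂ} {c : ℂ}
    (hg : ∀ᶠ q in 𝓝 ((0 : ℂ), c), DifferentiableAt ℂ g q ∧ pdx g q = 0)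
    (h0 : ∀ᶠ t in 𝓝 c, g (0, t) = 0) : ∀ᶠ q in 𝓝 ((0 : ℂ), c), g q = 0 := by
  obtain ⟨r, hr, hball⟩ := Metric.eventually_nhds_iff_ball.mp hg
  rw [← ball_prod_same] at hball
  have h0' : ∀ᶠ q in 𝓝 ((0 : ℂ), c), g (0, q.2) = 0 :=
    (continuous_snd.tendsto ((0 : ℂ), c)).eventually h0
  filter_upwards [Metric.ball_mem_nhds ((0 : ℂ), c) hr, h0'] with q hq hq0
  rw [← ball_prod_same] at hq
  have hd : ∀ s ∈ Metric.ball (0 : ℂ) r, HasDerivAt (fun s => g (s, q.2)) 0 s := fun s hs => by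
    have := hball (s, q.2) ⟨hs, hq.2⟩
    exact (hasDerivAt_fst_of_differentiableAt this.1).congr_deriv this.2
  have := Metric.isOpen_ball.is_const_of_deriv_eq_zero
    (convex_ball (0 : ℂ) r).isPreconnected
    (fun s hs => (hd s hs).differentiableAt.differentiableWithinAt)
    (fun s hs => (hd s hs).deriv) hq.1 (Metric.mem_ball_self hr)
  exact this.trans hq0

/-- The local uniqueness statement at a point of `{x = 0}` where `f_y ≠ 0`. -/
theorem eventually_eq_zero_of_pdy_ne_zero {f h : ℂ × ℂ → ℂ} {y : ℂ}
    (hf : AnalyticAt ℂ f (0, y)) (hh : AnalyticAt ℂ h (0, y)) (hfy : pdy f (0, y) ≠ 0)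
    (hwedge : ∀ᶠ z in 𝓝 ((0 : ℂ), y), pdx f z * pdy h z - pdy f z * pdx h z = 0)
    (hvan : ∀ᶠ t in 𝓝 y, h (0, t) = 0) :
    ∀ᶠ z in 𝓝 ((0 : ℂ), y), h z = 0 := by
  obtain ⟨Ψ, hΨ, hΨp, hinv, hleft⟩ := exists_local_inverse_fst_prod hf hfy
  have hΨt : Tendsto Ψ (𝓝 ((0 : ℂ), f (0, y))) (𝓝 ((0 : ℂ), y)) := by
    have := hΨ.continuousAt.tendsto
    rwa [hΨp] at this
  have hfy' : ∀ᶠ z in 𝓝 ((0 : ℂ), y), pdy f z ≠ 0 := by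
    have : ContinuousAt (pdy f) (0, y) :=
      hf.fderiv.continuousAt.clm_apply continuousAt_const
    exact this.eventually_ne hfy
  have hg : ∀ᶠ q in 𝓝 ((0 : ℂ), f (0, y)),
      DifferentiableAt ℂ (h ∘ Ψ) q ∧ pdx (h ∘ Ψ) q = 0 := by
    filter_upwards [hΨ.eventually_analyticAt, hinv.eventually_nhds,
      hΨt.eventually hf.eventually_analyticAt, hΨt.eventually hh.eventually_analyticAt,
      hΨt.eventually hfy', hΨt.eventually hwedge] with q h1 h2 h3 h4 h5 h6
    exact ⟨h4.differentiableAt.comp q h1.differentiableAt,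
      pdx_comp_eq_zero_of_wedge_eq_zero h1.differentiableAt h3.differentiableAt
        h4.differentiableAt h5 h6 h2⟩
  have h0 : ∀ᶠ t in 𝓝 (f (0, y)), (h ∘ Ψ) (0, t) = 0 := by
    have hline : Tendsto (fun t : ℂ => ((0 : ℂ), t)) (𝓝 (f (0, y))) (𝓝 (0, f (0, y))) :=
      (by fun_prop : Continuous fun t : ℂ => ((0 : ℂ), t)).tendsto _
    have hvan' : ∀ᶠ z in 𝓝 ((0 : ℂ), y), h (0, z.2) = 0 :=
      (continuous_snd.tendsto ((0 : ℂ), y)).eventually hvan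
    filter_upwards [hline.eventually hinv, hline.eventually (hΨt.eventually hvan')] with t h1 h2
    have : Ψ (0, t) = (0, (Ψ (0, t)).2) := Prod.ext h1.1 rfl
    rw [Function.comp_apply, this]
    exact h2
  have hΦ : Tendsto (fun z : ℂ × ℂ => (z.1, f z)) (𝓝 (0, y)) (𝓝 (0, f (0, y))) :=
    (continuousAt_fst.prodMk hf.continuousAt).tendsto
  filter_upwards [hΦ.eventually (eventually_eq_zero_of_pdx_eq_zero hg h0), hleft] with z h1 h2
  rwa [Function.comp_apply, h2] at h1

/-- If `f(0, ·)` is not constant near `0`, then `f_y` is nonzero at points of `{x = 0}`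
arbitrarily close to `0`. -/
theorem frequently_pdy_ne_zero {f : ℂ × ℂ → ℂ} (hf : AnalyticAt ℂ f 0)
    (hnc : ¬ ∀ᶠ y in 𝓝 (0 : ℂ), f (0, y) = f (0, 0)) :
    ∃ᶠ y in 𝓝 (0 : ℂ), pdy f (0, y) ≠ 0 := by
  intro hzero
  apply hnc
  have hline : Tendsto (fun t : ℂ => ((0 : ℂ), t)) (𝓝 0) (𝓝 0) :=
    (by fun_prop : Continuous fun t : ℂ => ((0 : ℂ), t)).tendsto 0
  obtain ⟨r, hr, hball⟩ := Metric.eventually_nhds_iff_ball.mp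
    (hzero.and (hline.eventually hf.eventually_analyticAt))
  have hd : ∀ y ∈ Metric.ball (0 : ℂ) r, HasDerivAt (fun t => f (0, t)) 0 y := fun y hy => by
    have := hball y hy
    exact (hasDerivAt_snd_of_differentiableAt this.2.differentiableAt).congr_deriv
      (not_not.mp this.1)
  filter_upwards [Metric.ball_mem_nhds (0 : ℂ) hr] with y hy
  exact Metric.isOpen_ball.is_const_of_deriv_eq_zero
    (convex_ball (0 : ℂ) r).isPreconnected
    (fun s hs => (hd s hs).differentiableAt.differentiableWithinAt)
    (fun s hs => (hd s hs).deriv) hy (Metric.mem_ball_self hr)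

/-- Absence of nonzero closed relative forms: if `f` has at most an isolated
singularity at `0` and `f(0,·)` is not constant near `0`, then any `h` with
`df ∧ dh = 0` vanishing on the line `{x = 0}` vanishes identically near `0`. -/
theorem no_nonzero_closed_relative_forms (f h : ℂ × ℂ → ℂ)
    (hf : AnalyticAt ℂ f 0)
    (hgrad : ∀ᶠ z in 𝓝 (0 : ℂ × ℂ), z ≠ 0 → (pdx f z ≠ 0 ∨ pdy f z ≠ 0))
    (hnc : ¬ ∀ᶠ y in 𝓝 (0 : ℂ), f (0, y) = f (0, 0))
    (hh : AnalyticAt ℂ h 0)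
    (hwedge : ∀ᶠ z in 𝓝 (0 : ℂ × ℂ), pdx f z * pdy h z - pdy f z * pdx h z = 0)
    (hvan : ∀ᶠ y in 𝓝 (0 : ℂ), h (0, y) = 0) :
    ∀ᶠ z in 𝓝 (0 : ℂ × ℂ), h z = 0 := by
  obtain ⟨r, hr, hball⟩ := Metric.eventually_nhds_iff_ball.mp hh.eventually_analyticAt
  have hline : Tendsto (fun t : ℂ => ((0 : ℂ), t)) (𝓝 0) (𝓝 0) :=
    (by fun_prop : Continuous fun t : ℂ => ((0 : ℂ), t)).tendsto 0
  obtain ⟨y, hfy, hyball, hfan, hw, hv⟩ := ((frequently_pdy_ne_zero hf hnc).and_eventually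
    ((hline.eventually (Metric.ball_mem_nhds (0 : ℂ × ℂ) hr)).and
      ((hline.eventually hf.eventually_analyticAt).and
        ((hline.eventually hwedge.eventually_nhds).and hvan.eventually_nhds)))).exists
  have hlocal := eventually_eq_zero_of_pdy_ne_zero hfan (hball _ hyball) hfy hw hv
  have hzero := AnalyticOnNhd.eqOn_zero_of_preconnected_of_eventuallyEq_zero
    (fun z hz => hball z hz) (convex_ball (0 : ℂ × ℂ) r).isPreconnected hyball hlocal
  filter_upwards [Metric.ball_mem_nhds (0 : ℂ × ℂ) hr] with z hz using hzero hz
end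

section
/- Quasihomogeneous division lemma (Lemma 4 of the paper): let f be a quasihomogeneous polynomial of type (m₁, m₂; 1). Then for all functions a, b analytic near 0 ∈ ℂ² (so that η = x·a dx + x²·b dy is an arbitrary element of x Ω¹_H), there exist functions T and h analytic near 0, with h divisible by x², such that f_x·x²·b − f_y·x·a = f·x·T + (f_x·h_y − f_y·h_x) near 0; i.e. df ∧ η = f·θ + df ∧ dh with θ = x·T dx∧dy ∈ x Ω² and h ∈ x Ω⁰_H. -/
open Filter Topology

/-- `f` is a quasihomogeneous polynomial of type `(m₁, m₂; 1)`: it is a finite sum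
of monomials `x^i y^j` with `m₁·i + m₂·j = 1`, where `m₁, m₂` are positive
rationals. -/
def Quasihomogeneous (m₁ m₂ : ℚ) (f : ℂ × ℂ → ℂ) : Prop :=
  0 < m₁ ∧ 0 < m₂ ∧
    ∃ (S : Finset (ℕ × ℕ)) (a : ℕ × ℕ → ℂ),
      (∀ p ∈ S, m₁ * (p.1 : ℚ) + m₂ * (p.2 : ℚ) = 1) ∧
      ∀ z : ℂ × ℂ, f z = ∑ p ∈ S, a p * z.1 ^ p.1 * z.2 ^ p.2

/-- The diagonal scaling `(x, y) ↦ (s ^ M * x, s ^ N * y)`. -/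
noncomputable def weightedScaling (M N : ℕ) (s : ℂ) : ℂ × ℂ →L[ℂ] ℂ × ℂ :=
  (s ^ M • ContinuousLinearMap.id ℂ ℂ).prodMap (s ^ N • ContinuousLinearMap.id ℂ ℂ)

@[simp]
lemma weightedScaling_apply (M N : ℕ) (s : ℂ) (z : ℂ × ℂ) :
    weightedScaling M N s z = (s ^ M * z.1, s ^ N * z.2) := by
  ext <;> simp [weightedScaling]

lemma continuous_weightedScaling (M N : ℕ) : Continuous (weightedScaling M N) := by
  have h : weightedScaling M N = fun s : ℂ =>
      s ^ M • (ContinuousLinearMap.id ℂ ℂ).prodMap (0 : ℂ →L[ℂ] ℂ) +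
        s ^ N • (0 : ℂ →L[ℂ] ℂ).prodMap (ContinuousLinearMap.id ℂ ℂ) := by
    ext s <;> simp
  rw [h]
  fun_prop

lemma norm_weightedScaling_le_one (M N : ℕ) {s : ℂ} (hs : ‖s‖ ≤ 1) :
    ‖weightedScaling M N s‖ ≤ 1 := by
  refine ContinuousLinearMap.opNorm_le_bound _ zero_le_one fun z => ?_
  have key (n : ℕ) (w : ℂ) : ‖s ^ n * w‖ ≤ ‖w‖ := by
    rw [norm_mul, norm_pow]
    exact mul_le_of_le_one_left (norm_nonneg _) (pow_le_one₀ (norm_nonneg _) hs)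
  rw [weightedScaling_apply, one_mul, Prod.norm_def, Prod.norm_def]
  exact max_le_max (key M _) (key N _)

/-- Averaging an analytic function over a continuous family of linear contractions, with a
continuous weight bounded by one, preserves power series expansions at the origin. -/
lemma HasFPowerSeriesOnBall.intervalIntegral_comp_clm {E : Type*} [NormedAddCommGroup E]
    [NormedSpace ℂ E] {r : E → ℂ} {p : FormalMultilinearSeries ℂ E ℂ} {R : ENNReal}
    (hr : HasFPowerSeriesOnBall r p 0 R) {D : ℝ → E →L[ℂ] E} (hD : Continuous D)
    (hD1 : ∀ s ∈ Set.Icc (0 : ℝ) 1, ‖D s‖ ≤ 1) {w : ℝ → ℂ} (hw : Continuous w)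
    (hw1 : ∀ s ∈ Set.Icc (0 : ℝ) 1, ‖w s‖ ≤ 1) :
    HasFPowerSeriesOnBall (fun z => ∫ s in (0 : ℝ)..1, w s * r (D s z))
      (fun n => ∫ s in (0 : ℝ)..1, w s • (p n).compContinuousLinearMap (fun _ => D s)) 0 R := by
  have hcont (n : ℕ) :
      Continuous fun s => w s • (p n).compContinuousLinearMap (fun _ => D s) := by
    refine hw.smul ?_
    have h1 : Continuous fun s : ℝ =>
        ContinuousMultilinearMap.compContinuousLinearMapContinuousMultilinear ℂ
          (fun _ : Fin n => E) (fun _ : Fin n => E) ℂ (fun _ => D s) :=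
      (ContinuousMultilinearMap.cont _).comp (continuous_pi fun _ => hD)
    exact h1.clm_apply continuous_const
  have hnorm (n : ℕ) (s : ℝ) (hs : s ∈ Set.Icc (0 : ℝ) 1) :
      ‖w s • (p n).compContinuousLinearMap (fun _ => D s)‖ ≤ ‖p n‖ := by
    rw [norm_smul]
    refine (mul_le_of_le_one_left (norm_nonneg _) (hw1 s hs)).trans ?_
    refine (ContinuousMultilinearMap.norm_compContinuousLinearMap_le _ _).trans ?_
    exact mul_le_of_le_one_right (norm_nonneg _)
      (Finset.prod_le_one (fun _ _ => norm_nonneg _) fun _ _ => hD1 s hs)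
  have hIcc {s : ℝ} (hs : s ∈ Set.uIoc (0 : ℝ) 1) : s ∈ Set.Icc (0 : ℝ) 1 := by
    rw [Set.uIoc_of_le zero_le_one] at hs
    exact ⟨hs.1.le, hs.2⟩
  refine ⟨?_, hr.r_pos, ?_⟩
  · refine hr.r_le.trans (FormalMultilinearSeries.radius_le_of_le fun n => ?_)
    simpa using intervalIntegral.norm_integral_le_of_norm_le_const
      (fun s hs => hnorm n s (hIcc hs))
  · intro z hz
    have hz' : (‖z‖₊ : ENNReal) < R := by simpa [enorm] using hz
    have hsum : Summable fun n => ‖p n‖ * ‖z‖ ^ n := by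
      simpa using p.summable_norm_mul_pow (hz'.trans_le hr.r_le)
    have happ (n : ℕ) :
        (∫ s in (0 : ℝ)..1, w s • (p n).compContinuousLinearMap (fun _ => D s)) (fun _ => z) =
          ∫ s in (0 : ℝ)..1, w s * p n (fun _ => D s z) := by
      have := (ContinuousMultilinearMap.apply ℂ (fun _ : Fin n => E) ℂ
        (fun _ => z)).intervalIntegral_comp_comm
          ((hcont n).intervalIntegrable (μ := MeasureTheory.volume) 0 1)
      simpa using this.symm
    simp only [happ, zero_add]
    refine intervalIntegral.hasSum_integral_of_dominated_convergence
      (fun n _ => ‖p n‖ * ‖z‖ ^ n) (fun n => ?_) (fun n => ?_) ?_ ?_ ?_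
    · refine Continuous.aestronglyMeasurable (hw.mul ?_)
      exact (p n).cont.comp (continuous_pi fun _ => hD.clm_apply continuous_const)
    · refine .of_forall fun s hs => ?_
      have h := ((w s • (p n).compContinuousLinearMap (fun _ => D s)).le_opNorm
        (fun _ => z)).trans (mul_le_mul_of_nonneg_right (hnorm n s (hIcc hs)) (by positivity))
      simpa using h
    · exact .of_forall fun _ _ => hsum
    · exact intervalIntegrable_const
    · refine .of_forall fun s hs => HasSum.mul_left _ ?_
      have hle : ‖D s z‖ ≤ ‖z‖ :=
        (D s).le_of_opNorm_le_of_le (hD1 s (hIcc hs)) le_rfl |>.trans_eq (one_mul _)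
      have hmem : D s z ∈ Metric.eball (0 : E) R := by
        have : (‖D s z‖₊ : ENNReal) ≤ ‖z‖₊ := by exact_mod_cast hle
        simpa [enorm] using this.trans_lt hz'
      simpa using hr.hasSum hmem

lemma fderiv_apply_prod (f : ℂ × ℂ → ℂ) (z : ℂ × ℂ) (u v : ℂ) :
    fderiv ℂ f z (u, v) = u * pdx f z + v * pdy f z := by
  have h : ((u, v) : ℂ × ℂ) = u • (1, 0) + v • (0, 1) := by simp
  rw [h, map_add, map_smul, map_smul, smul_eq_mul, smul_eq_mul, pdx, pdy]

/-- The first-order equation `(k + 1 + M x ∂ₓ + N y ∂_y) g = r` has an analytic solution. -/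
lemma exists_analyticAt_euler_add_eq (M N k : ℕ) {r : ℂ × ℂ → ℂ} (hr : AnalyticAt ℂ r 0) :
    ∃ g : ℂ × ℂ → ℂ, AnalyticAt ℂ g 0 ∧ ∀ᶠ z in 𝓝 (0 : ℂ × ℂ),
      (k + 1) * g z + M * z.1 * pdx g z + N * z.2 * pdy g z = r z := by
  obtain ⟨p, R, hp⟩ := hr
  let D : ℝ → ℂ × ℂ →L[ℂ] ℂ × ℂ := fun s => weightedScaling M N s
  have hD : Continuous D := (continuous_weightedScaling M N).comp Complex.continuous_ofReal
  have hn {s : ℝ} (hs : s ∈ Set.Icc (0 : ℝ) 1) : ‖(s : ℂ)‖ ≤ 1 := by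
    rw [Complex.norm_real, Real.norm_of_nonneg hs.1]
    exact hs.2
  have hD1 (s : ℝ) (hs : s ∈ Set.Icc (0 : ℝ) 1) : ‖D s‖ ≤ 1 :=
    norm_weightedScaling_le_one M N (hn hs)
  have hg := hp.intervalIntegral_comp_clm hD hD1 (w := fun s => (s : ℂ) ^ k) (by fun_prop)
    (fun s hs => by rw [norm_pow]; exact pow_le_one₀ (norm_nonneg _) (hn hs))
  set g : ℂ × ℂ → ℂ := fun z => ∫ s in (0 : ℝ)..1, (s : ℂ) ^ k * r (D s z) with hgdef
  refine ⟨g, hg.analyticAt, ?_⟩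
  filter_upwards [Metric.eball_mem_nhds (0 : ℂ × ℂ) hp.r_pos] with z hz
  have hdiff : HasFDerivAt g (fderiv ℂ g z) z :=
    (hg.analyticAt_of_mem hz).differentiableAt.hasFDerivAt
  have hscale (t : ℝ) : (t : ℂ) ^ (k + 1) * g ((t : ℂ) ^ M * z.1, (t : ℂ) ^ N * z.2) =
      ∫ s in (0 : ℝ)..t, (s : ℂ) ^ k * r (D s z) := by
    have h := intervalIntegral.smul_integral_comp_mul_left
      (a := 0) (b := 1) (fun s : ℝ => (s : ℂ) ^ k * r (D s z)) t
    rw [mul_zero, mul_one] at h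
    rw [← h, hgdef, Complex.real_smul, pow_succ', mul_assoc,
      ← intervalIntegral.integral_const_mul]
    congr 2
    ext s
    simp only [D, weightedScaling_apply, Complex.ofReal_mul, mul_pow]
    rw [← mul_assoc]
    congr 3 <;> ring_nf
  have hleft : HasDerivAt
      (fun t : ℝ => (t : ℂ) ^ (k + 1) * g ((t : ℂ) ^ M * z.1, (t : ℂ) ^ N * z.2))
      ((k + 1) * g z + fderiv ℂ g z (M * z.1, N * z.2)) 1 := by
    have hpow (n : ℕ) : HasDerivAt (fun t : ℂ => t ^ n) (n : ℂ) 1 := by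
      simpa using hasDerivAt_pow n (1 : ℂ)
    have hcurve : HasDerivAt (fun t : ℂ => (t ^ M * z.1, t ^ N * z.2))
        (M * z.1, N * z.2) (1 : ℂ) :=
      ((hpow M).mul_const z.1).prodMk ((hpow N).mul_const z.2)
    have hcomp := HasFDerivAt.comp_hasDerivAt_of_eq (1 : ℂ) hdiff hcurve (by simp)
    have hmul := (hpow (k + 1)).mul hcomp
    have hreal := HasDerivAt.comp_ofReal (z := 1) (by simpa using hmul)
    simpa using hreal
  have hopen : IsOpen {s : ℝ | D s z ∈ Metric.eball (0 : ℂ × ℂ) R} :=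
    Metric.isOpen_eball.preimage (hD.clm_apply continuous_const)
  have hcont : ContinuousOn (fun s : ℝ => (s : ℂ) ^ k * r (D s z))
      {s : ℝ | D s z ∈ Metric.eball (0 : ℂ × ℂ) R} := by
    refine ContinuousOn.mul (by fun_prop) ?_
    exact hp.continuousOn.comp (hD.clm_apply continuous_const).continuousOn fun s hs => hs
  have hIcc : Set.Icc (0 : ℝ) 1 ⊆ {s : ℝ | D s z ∈ Metric.eball (0 : ℂ × ℂ) R} := by
    intro s hs
    have hle : ‖D s z‖ ≤ ‖z‖ :=
      (D s).le_of_opNorm_le_of_le (hD1 s hs) le_rfl |>.trans_eq (one_mul _)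
    have hle' : (‖D s z‖₊ : ENNReal) ≤ ‖z‖₊ := by exact_mod_cast hle
    have hz' : (‖z‖₊ : ENNReal) < R := by simpa [enorm] using hz
    simpa [enorm] using hle'.trans_lt hz'
  have hone : (1 : ℝ) ∈ {s : ℝ | D s z ∈ Metric.eball (0 : ℂ × ℂ) R} := hIcc (by simp)
  have hright : HasDerivAt (fun t : ℝ => ∫ s in (0 : ℝ)..t, (s : ℂ) ^ k * r (D s z))
      (r z) 1 := by
    have h := intervalIntegral.integral_hasDerivAt_right
      ((hcont.mono hIcc).intervalIntegrable_of_Icc zero_le_one)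
      (hcont.stronglyMeasurableAtFilter hopen 1 hone) (hcont.continuousAt (hopen.mem_nhds hone))
    simpa [D] using h
  rw [← funext hscale] at hright
  have := hleft.unique hright
  rw [fderiv_apply_prod] at this
  rw [← this]
  ring

lemma hasFDerivAt_monomial (c : ℂ) (i j : ℕ) (z : ℂ × ℂ) :
    HasFDerivAt (fun z : ℂ × ℂ => c * z.1 ^ i * z.2 ^ j)
      ((c * z.1 ^ i) • ((j * z.2 ^ (j - 1)) • ContinuousLinearMap.snd ℂ ℂ ℂ) +
        (z.2 ^ j) • (c • ((i * z.1 ^ (i - 1)) • ContinuousLinearMap.fst ℂ ℂ ℂ))) z := by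
  have h1 := ((hasFDerivAt_fst (𝕜 := ℂ) (p := z)).pow i).const_mul c
  have h2 := (hasFDerivAt_snd (𝕜 := ℂ) (p := z)).pow j
  refine (h1.mul h2).congr_fderiv ?_
  ext <;> simp

lemma Quasihomogeneous.euler {m₁ m₂ : ℚ} {f : ℂ × ℂ → ℂ} (hf : Quasihomogeneous m₁ m₂ f)
    (z : ℂ × ℂ) : m₁ * z.1 * pdx f z + m₂ * z.2 * pdy f z = f z := by
  obtain ⟨-, -, S, a, hS, hfz⟩ := hf
  have hderiv := HasFDerivAt.fun_sum fun p (_ : p ∈ S) => hasFDerivAt_monomial (a p) p.1 p.2 z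
  rw [← fderiv_apply_prod, funext hfz, hderiv.fderiv, sum_apply]
  refine Finset.sum_congr rfl fun p hp => ?_
  have hw : (m₁ : ℂ) * p.1 + m₂ * p.2 = 1 := by exact_mod_cast hS p hp
  have hpow (n : ℕ) (w : ℂ) : (n : ℂ) * w ^ (n - 1) * w = n * w ^ n := by
    cases n <;> simp [pow_succ, mul_assoc]
  simp only [add_apply, smul_apply, smul_eq_mul,
    ContinuousLinearMap.coe_fst', ContinuousLinearMap.coe_snd']
  linear_combination (a p * z.1 ^ p.1 * z.2 ^ p.2) * hw + a p * z.1 ^ p.1 * m₂ * hpow p.2 z.2 +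
    a p * z.2 ^ p.2 * m₁ * hpow p.1 z.1

/-- Quasihomogeneous division lemma (Lemma 4): for quasihomogeneous `f` of type
`(m₁, m₂; 1)` and any `η = x·a dx + x²·b dy ∈ x Ω¹_H`, one can write
`df ∧ η = f·θ + df ∧ dh` with `θ = x·T dx∧dy ∈ x Ω²` and `h ∈ x Ω⁰_H`. -/
theorem quasihomogeneous_division (m₁ m₂ : ℚ) (f : ℂ × ℂ → ℂ)
    (hqh : Quasihomogeneous m₁ m₂ f)
    (a b : ℂ × ℂ → ℂ) (ha : AnalyticAt ℂ a 0) (hb : AnalyticAt ℂ b 0) :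
    ∃ T h : ℂ × ℂ → ℂ, AnalyticAt ℂ T 0 ∧ AnalyticAt ℂ h 0 ∧ DivX2 h ∧
      ∀ᶠ z in 𝓝 (0 : ℂ × ℂ),
        pdx f z * (z.1 ^ 2 * b z) - pdy f z * (z.1 * a z) =
          f z * (z.1 * T z) + (pdx f z * pdy h z - pdy f z * pdx h z) := by
  obtain ⟨L, M, N, hL, hM, hLM, hLN⟩ :
      ∃ L M N : ℕ, L ≠ 0 ∧ M ≠ 0 ∧ (L : ℂ) * m₁ = M ∧ (L : ℂ) * m₂ = N := by
    have h₁ : (m₁.num.toNat : ℚ) = m₁ * m₁.den := by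
      rw [Rat.mul_den_eq_num]
      exact_mod_cast Int.toNat_of_nonneg (Rat.num_nonneg.2 hqh.1.le)
    have h₂ : (m₂.num.toNat : ℚ) = m₂ * m₂.den := by
      rw [Rat.mul_den_eq_num]
      exact_mod_cast Int.toNat_of_nonneg (Rat.num_nonneg.2 hqh.2.1.le)
    refine ⟨m₁.den * m₂.den, m₁.num.toNat * m₂.den, m₂.num.toNat * m₁.den,
      mul_ne_zero m₁.den_nz m₂.den_nz, mul_ne_zero ?_ m₂.den_nz, ?_, ?_⟩
    · have := Rat.num_pos.2 hqh.1
      omega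
    · have : ((m₁.den * m₂.den : ℕ) : ℚ) * m₁ = (m₁.num.toNat * m₂.den : ℕ) := by
        push_cast
        rw [h₁]
        ring
      exact_mod_cast this
    · have : ((m₁.den * m₂.den : ℕ) : ℚ) * m₂ = (m₂.num.toNat * m₁.den : ℕ) := by
        push_cast
        rw [h₂]
        ring
      exact_mod_cast this
  have hL' : (L : ℂ) ≠ 0 := Nat.cast_ne_zero.2 hL
  have hm₁ : (m₁ : ℂ) ≠ 0 := by exact_mod_cast hqh.1.ne'
  have hr : AnalyticAt ℂ (fun z => M * a z + N * z.2 * b z) 0 :=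
    (analyticAt_const.mul ha).add ((analyticAt_const.mul analyticAt_snd).mul hb)
  obtain ⟨g, hg, hgeq⟩ := exists_analyticAt_euler_add_eq M N (2 * M - 1) hr
  have hk : ((2 * M - 1 : ℕ) : ℂ) + 1 = 2 * M := by
    have : 2 * M - 1 + 1 = 2 * M := by omega
    exact_mod_cast this
  have hpdy : AnalyticAt ℂ (pdy g) 0 := 
    (ContinuousLinearMap.apply ℂ ℂ ((0, 1) : ℂ × ℂ)).analyticAt _ |>.comp hg.fderiv
  refine ⟨fun z => (b z - pdy g z) / m₁, fun z => z.1 ^ 2 * g z, (hb.sub hpdy).div analyticAt_const hm₁,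
    (analyticAt_fst.pow 2).mul hg, ⟨g, hg, .of_forall fun _ => rfl⟩, ?_⟩
  filter_upwards [hgeq, hg.eventually_analyticAt] with z hz hgz
  have hsq : HasFDerivAt (fun z : ℂ × ℂ => z.1 ^ 2)
      ((2 * z.1) • ContinuousLinearMap.fst ℂ ℂ ℂ) z := by
    simpa using (hasFDerivAt_fst (𝕜 := ℂ) (p := z)).pow 2
  have hh := (hsq.fun_mul hgz.differentiableAt.hasFDerivAt).fderiv
  have hx : pdx (fun z => z.1 ^ 2 * g z) z = z.1 ^ 2 * pdx g z + 2 * z.1 * g z := by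
    rw [pdx, hh]
    simp [pdx, mul_comm]
  have hy : pdy (fun z => z.1 ^ 2 * g z) z = z.1 ^ 2 * pdy g z := by
    rw [pdy, hh]
    simp [pdy]
  have heuler := hqh.euler z
  rw [hk, ← hLM, ← hLN] at hz
  have hz' : 2 * m₁ * g z + m₁ * z.1 * pdx g z + m₂ * z.2 * pdy g z =
      m₁ * a z + m₂ * z.2 * b z := by
    apply mul_left_cancel₀ hL'
    linear_combination hz
  rw [hx, hy]
  field_simp
  linear_combination z.1 * (b z - pdy g z) * heuler + pdy f z * z.1 * hz'
end

section
/- Norm bound for the inverted Euler operator (Lemma 6 of the paper): let m₁, m₂ be positive rationals, M = m₁ + m₂, m₀ = min(m₁, m₂), and let r = (r₁, r₂) with r₁, r₂ > 0 and r₀ = min(r₁, r₂). Let T, η₁, η₂ be formal power series in two variables x₁, x₂ over ℂ and suppose m₁·x₁·∂T/∂x₁ + m₂·x₂·∂T/∂x₂ + M·T = ∂η₁/∂x₁ − ∂η₂/∂x₂ (i.e. L_{E_f} θ = dη for θ = T dx₁∧dx₂ and η = η₂ dx₁ + η₁ dx₂). Then |T|_r ≤ (1/(m₀·r₀))·(|η₁|_r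 + |η₂|_r). -/
open Filter Topology

/-- The pseudonorm `|φ|_r = Σ |φ_{ij}| r₁^i r₂^j ∈ [0, ∞]` of a formal power series
in two variables, given by its coefficients `φ : ℕ → ℕ → ℂ`. -/
noncomputable def pnorm (φ : ℕ → ℕ → ℂ) (r₁ r₂ : NNReal) : ENNReal :=
  ∑' p : ℕ × ℕ, (‖φ p.1 p.2‖₊ : ENNReal) * (r₁ : ENNReal) ^ p.1 * (r₂ : ENNReal) ^ p.2

/-- If the weights `m₁`, `m₂` are at least `m > 0`, the coefficients of `T` in
`L_E T = ∂η₁ - ∂η₂` satisfy `m |T_{ij}| ≤ |η₁_{i+1,j}| + |η₂_{i,j+1}|`. -/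
lemma mul_norm_le_of_euler_eq {m m₁ m₂ : ℝ} (hm : 0 < m) (h₁ : m ≤ m₁) (h₂ : m ≤ m₂)
    (i j : ℕ) {t a b : ℂ}
    (h : ((m₁ * i + m₂ * j + (m₁ + m₂) : ℝ) : ℂ) * t = ((i : ℂ) + 1) * a - ((j : ℂ) + 1) * b) :
    m * ‖t‖ ≤ ‖a‖ + ‖b‖ := by
  have hi : (0 : ℝ) ≤ i := i.cast_nonneg
  have hj : (0 : ℝ) ≤ j := j.cast_nonneg
  have hnat (n : ℕ) : ‖(n : ℂ) + 1‖ = (n : ℝ) + 1 := by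
    exact_mod_cast Complex.norm_natCast (n + 1)
  have hlam : m * (i + j + 2) ≤ m₁ * i + m₂ * j + (m₁ + m₂) := by
    nlinarith [mul_le_mul_of_nonneg_right h₁ hi, mul_le_mul_of_nonneg_right h₂ hj]
  have hnorm : (m₁ * i + m₂ * j + (m₁ + m₂)) * ‖t‖ ≤ (i + 1) * ‖a‖ + (j + 1) * ‖b‖ := by
    have hpos : 0 ≤ m₁ * i + m₂ * j + (m₁ + m₂) := le_trans (by positivity) hlam
    calc (m₁ * i + m₂ * j + (m₁ + m₂)) * ‖t‖
        = ‖((m₁ * i + m₂ * j + (m₁ + m₂) : ℝ) : ℂ) * t‖ := by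
          rw [norm_mul, Complex.norm_of_nonneg hpos]
      _ ≤ ‖((i : ℂ) + 1) * a‖ + ‖((j : ℂ) + 1) * b‖ := by
          rw [h]
          exact norm_sub_le _ _
      _ = (i + 1) * ‖a‖ + (j + 1) * ‖b‖ := by rw [norm_mul, norm_mul, hnat, hnat]
  refine le_of_mul_le_mul_left (a := (i : ℝ) + j + 2) ?_ (by positivity)
  nlinarith [mul_le_mul_of_nonneg_right hlam (norm_nonneg t), norm_nonneg a, norm_nonneg b,
    mul_nonneg hi (norm_nonneg b), mul_nonneg hj (norm_nonneg a)]

lemma tsum_shift_fst_le_pnorm (φ : ℕ → ℕ → ℂ) (r₁ r₂ : NNReal) :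
    ∑' p : ℕ × ℕ, (‖φ (p.1 + 1) p.2‖₊ : ENNReal) * (r₁ : ENNReal) ^ (p.1 + 1) *
      (r₂ : ENNReal) ^ p.2 ≤ pnorm φ r₁ r₂ :=
  ENNReal.tsum_comp_le_tsum_of_injective
    ((add_left_injective 1).prodMap Function.injective_id : Function.Injective
      (Prod.map (fun n : ℕ => n + 1) (id : ℕ → ℕ)))
    (fun p : ℕ × ℕ => (‖φ p.1 p.2‖₊ : ENNReal) * (r₁ : ENNReal) ^ p.1 * (r₂ : ENNReal) ^ p.2)

lemma tsum_shift_snd_le_pnorm (φ : ℕ → ℕ → ℂ) (r₁ r₂ : NNReal) :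
    ∑' p : ℕ × ℕ, (‖φ p.1 (p.2 + 1)‖₊ : ENNReal) * (r₁ : ENNReal) ^ p.1 *
      (r₂ : ENNReal) ^ (p.2 + 1) ≤ pnorm φ r₁ r₂ :=
  ENNReal.tsum_comp_le_tsum_of_injective
    (Function.injective_id.prodMap (add_left_injective 1) : Function.Injective
      (Prod.map (id : ℕ → ℕ) (fun n : ℕ => n + 1)))
    (fun p : ℕ × ℕ => (‖φ p.1 p.2‖₊ : ENNReal) * (r₁ : ENNReal) ^ p.1 * (r₂ : ENNReal) ^ p.2)

/-- Norm bound for the inverted Euler operator (Lemma 6): if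
`L_{E_f} θ = dη` for `θ = T dx₁∧dx₂` and `η = η₂ dx₁ + η₁ dx₂`, i.e.
`m₁ x₁ ∂T/∂x₁ + m₂ x₂ ∂T/∂x₂ + (m₁+m₂)·T = ∂η₁/∂x₁ − ∂η₂/∂x₂` coefficientwise,
then `|T|_r ≤ (m₀ r₀)⁻¹ (|η₁|_r + |η₂|_r)` with `m₀ = min(m₁,m₂)`,
`r₀ = min(r₁,r₂)`. -/
theorem inverted_euler_operator_bound (m₁ m₂ : ℚ) (hm₁ : 0 < m₁) (hm₂ : 0 < m₂)
    (r₁ r₂ : NNReal) (hr₁ : 0 < r₁) (hr₂ : 0 < r₂)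
    (T η₁ η₂ : ℕ → ℕ → ℂ)
    (heq : ∀ i j : ℕ,
      ((m₁ * (i : ℚ) + m₂ * (j : ℚ) + (m₁ + m₂) : ℚ) : ℂ) * T i j =
        ((i : ℂ) + 1) * η₁ (i + 1) j - ((j : ℂ) + 1) * η₂ i (j + 1)) :
    pnorm T r₁ r₂ ≤
      (ENNReal.ofReal ((min m₁ m₂ : ℚ) : ℝ) * ((min r₁ r₂ : NNReal) : ENNReal))⁻¹ *
        (pnorm η₁ r₁ r₂ + pnorm η₂ r₁ r₂) := by
  have hm : (0 : ℝ) < ((min m₁ m₂ : ℚ) : ℝ) := by exact_mod_cast lt_min hm₁ hm₂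
  have hr : 0 < min r₁ r₂ := lt_min hr₁ hr₂
  have hcoeff (i j : ℕ) : ENNReal.ofReal ((min m₁ m₂ : ℚ) : ℝ) * (‖T i j‖₊ : ENNReal) ≤
      (‖η₁ (i + 1) j‖₊ : ENNReal) + (‖η₂ i (j + 1)‖₊ : ENNReal) := by
    have h := mul_norm_le_of_euler_eq (m₁ := m₁) (m₂ := m₂) hm
      (by exact_mod_cast min_le_left m₁ m₂) (by exact_mod_cast min_le_right m₁ m₂) i j
      (t := T i j) (a := η₁ (i + 1) j) (b := η₂ i (j + 1))
      (by rw [← heq i j]; push_cast; rfl)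
    simp only [← enorm_eq_nnnorm, ← ofReal_norm]
    rw [← ENNReal.ofReal_mul hm.le, ← ENNReal.ofReal_add (norm_nonneg _) (norm_nonneg _)]
    exact ENNReal.ofReal_le_ofReal h
  rw [mul_comm _ (pnorm η₁ r₁ r₂ + pnorm η₂ r₁ r₂), ← div_eq_mul_inv]
  have h0 : ENNReal.ofReal ((min m₁ m₂ : ℚ) : ℝ) * ((min r₁ r₂ : NNReal) : ENNReal) ≠ 0 :=
    mul_ne_zero (ENNReal.ofReal_pos.2 hm).ne' (ENNReal.coe_ne_zero.2 hr.ne')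
  have htop : ENNReal.ofReal ((min m₁ m₂ : ℚ) : ℝ) * ((min r₁ r₂ : NNReal) : ENNReal) ≠ ⊤ :=
    ENNReal.mul_ne_top ENNReal.ofReal_ne_top ENNReal.coe_ne_top
  rw [ENNReal.le_div_iff_mul_le (Or.inl h0) (Or.inl htop), mul_comm]
  refine le_trans ?_ (add_le_add (tsum_shift_fst_le_pnorm η₁ r₁ r₂)
    (tsum_shift_snd_le_pnorm η₂ r₁ r₂))
  rw [pnorm, ← ENNReal.tsum_mul_left, ← ENNReal.tsum_add]
  refine ENNReal.tsum_le_tsum fun ⟨i, j⟩ => ?_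
  have hle₁ : ((min r₁ r₂ : NNReal) : ENNReal) ≤ r₁ := ENNReal.coe_le_coe.2 (min_le_left _ _)
  have hle₂ : ((min r₁ r₂ : NNReal) : ENNReal) ≤ r₂ := ENNReal.coe_le_coe.2 (min_le_right _ _)
  generalize ((min r₁ r₂ : NNReal) : ENNReal) = ρ at hle₁ hle₂ ⊢
  calc ENNReal.ofReal ((min m₁ m₂ : ℚ) : ℝ) * ρ *
        ((‖T i j‖₊ : ENNReal) * (r₁ : ENNReal) ^ i * (r₂ : ENNReal) ^ j)
      = ENNReal.ofReal ((min m₁ m₂ : ℚ) : ℝ) * (‖T i j‖₊ : ENNReal) *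
          (ρ * ((r₁ : ENNReal) ^ i * (r₂ : ENNReal) ^ j)) := by ring
    _ ≤ ((‖η₁ (i + 1) j‖₊ : ENNReal) + (‖η₂ i (j + 1)‖₊ : ENNReal)) *
          (ρ * ((r₁ : ENNReal) ^ i * (r₂ : ENNReal) ^ j)) := by
        gcongr
        exact hcoeff i j
    _ = (‖η₁ (i + 1) j‖₊ : ENNReal) * (ρ * ((r₁ : ENNReal) ^ i * (r₂ : ENNReal) ^ j)) +
          (‖η₂ i (j + 1)‖₊ : ENNReal) * (ρ * ((r₁ : ENNReal) ^ i * (r₂ : ENNReal) ^ j)) :=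
        add_mul _ _ _
    _ ≤ (‖η₁ (i + 1) j‖₊ : ENNReal) * (r₁ * ((r₁ : ENNReal) ^ i * (r₂ : ENNReal) ^ j)) +
          (‖η₂ i (j + 1)‖₊ : ENNReal) * (r₂ * ((r₁ : ENNReal) ^ i * (r₂ : ENNReal) ^ j)) := by
        gcongr
    _ = (‖η₁ (i + 1) j‖₊ : ENNReal) * (r₁ : ENNReal) ^ (i + 1) * (r₂ : ENNReal) ^ j +
          (‖η₂ i (j + 1)‖₊ : ENNReal) * (r₁ : ENNReal) ^ i * (r₂ : ENNReal) ^ (j + 1) := by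
        ring
end

section
/- Norm bound for the relative Poincaré lemma (Lemma 7 of the paper): let r = (r₁, r₂) with r₁, r₂ > 0 and R = r₁ + r₂. Let π₁, π₂ be formal power series in x, y over ℂ with x dividing π₁, x² dividing π₂, ∂π₁/∂y = ∂π₂/∂x (i.e. the 1-form π = π₁ dx + π₂ dy lies in x Ω¹_H and is closed), and |π₁|_r + |π₂|_r < ∞. Then there exists a formal power series ζ, divisible by x², with ∂ζ/∂x = π₁, ∂ζ/∂y = π₂ (i.e. π = dζ with ζ ∈ x Ω⁰_H) and |ζ|_r ≤ R·(|π₁|_r + |π₂|_r). -/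
open Filter Topology

/-- The power series `∫₀ˣ φ dx`. -/
noncomputable def integralX (φ : ℕ → ℕ → ℂ) : ℕ → ℕ → ℂ
  | 0, _ => 0
  | i + 1, j => φ i j / ((i : ℂ) + 1)

theorem pnorm_integralX_le (φ : ℕ → ℕ → ℂ) (r₁ r₂ : NNReal) :
    pnorm (integralX φ) r₁ r₂ ≤ r₁ * pnorm φ r₁ r₂ := by
  have hcoeff (i j : ℕ) : ‖integralX φ (i + 1) j‖₊ ≤ ‖φ i j‖₊ := by
    have hi : ‖(i : ℂ) + 1‖ = (i : ℝ) + 1 := by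
      exact_mod_cast Complex.norm_natCast (i + 1)
    rw [← NNReal.coe_le_coe, coe_nnnorm, coe_nnnorm, integralX, norm_div, hi]
    exact div_le_self (norm_nonneg _) (by linarith [Nat.cast_nonneg (α := ℝ) i])
  unfold pnorm
  rw [ENNReal.tsum_prod', ENNReal.tsum_prod', tsum_eq_zero_add' ENNReal.summable]
  simp only [integralX, nnnorm_zero, ENNReal.coe_zero, zero_mul, tsum_zero, zero_add,
    ← ENNReal.tsum_mul_left]
  refine ENNReal.tsum_le_tsum fun i => ENNReal.tsum_le_tsum fun j => ?_
  calc (‖integralX φ (i + 1) j‖₊ : ENNReal) * (r₁ : ENNReal) ^ (i + 1) * (r₂ : ENNReal) ^ j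
      ≤ (‖φ i j‖₊ : ENNReal) * (r₁ : ENNReal) ^ (i + 1) * (r₂ : ENNReal) ^ j := by
        gcongr
        exact hcoeff i j
    _ = r₁ * ((‖φ i j‖₊ : ENNReal) * (r₁ : ENNReal) ^ i * (r₂ : ENNReal) ^ j) := by ring

/-- Norm bound for the relative Poincaré lemma (Lemma 7): a closed formal 1-form
`π = π₁ dx + π₂ dy ∈ x Ω¹_H` (`x ∣ π₁`, `x² ∣ π₂`, `∂π₁/∂y = ∂π₂/∂x`) with finite
pseudonorm is `dζ` for some `ζ ∈ x Ω⁰_H` (`x² ∣ ζ`) with `|ζ|_r ≤ R·|π|_r`,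
`R = r₁ + r₂`. -/
theorem relative_poincare_bound (r₁ r₂ : NNReal) (hr₁ : 0 < r₁) (hr₂ : 0 < r₂)
    (π₁ π₂ : ℕ → ℕ → ℂ)
    (hdiv₁ : ∀ j, π₁ 0 j = 0)
    (hdiv₂ : ∀ j, π₂ 0 j = 0) (hdiv₂' : ∀ j, π₂ 1 j = 0)
    (hclosed : ∀ i j : ℕ, ((j : ℂ) + 1) * π₁ i (j + 1) = ((i : ℂ) + 1) * π₂ (i + 1) j)
    (hfin : pnorm π₁ r₁ r₂ + pnorm π₂ r₁ r₂ < ⊤) :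
    ∃ ζ : ℕ → ℕ → ℂ, (∀ j, ζ 0 j = 0) ∧ (∀ j, ζ 1 j = 0) ∧
      (∀ i j : ℕ, ((i : ℂ) + 1) * ζ (i + 1) j = π₁ i j) ∧
      (∀ i j : ℕ, ((j : ℂ) + 1) * ζ i (j + 1) = π₂ i j) ∧
      pnorm ζ r₁ r₂ ≤ ((r₁ : ENNReal) + (r₂ : ENNReal)) * (pnorm π₁ r₁ r₂ + pnorm π₂ r₁ r₂) := by
  have hne (i : ℕ) : (i : ℂ) + 1 ≠ 0 := Nat.cast_add_one_ne_zero i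
  refine ⟨integralX π₁, fun j => rfl, fun j => ?_, fun i j => ?_, fun i j => ?_, ?_⟩
  · simp [integralX, hdiv₁]
  · exact mul_div_cancel₀ _ (hne i)
  · cases i with
    | zero => simp [integralX, hdiv₂]
    | succ i => rw [integralX, ← mul_div_assoc, hclosed, mul_div_cancel_left₀ _ (hne i)]
  · exact (pnorm_integralX_le π₁ r₁ r₂).trans (mul_le_mul' le_self_add le_self_add)
end

section
/- Analytic solvability of the singular ODE arising in the Martinet Morse lemma: let c be a function of one complex variable, analytic near 0 ∈ ℂ, with c(0) = 1. Then there exists a unique function w, analytic near 0 ∈ ℂ, with w(0) = 1, satisfying (2/5)·t·w'(t) + w(t) = c(t) for all t in a neighborhood of 0. -/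
open Filter Topology

/-- For `0 ≤ re κ` the Euler-type equation `κ t w' + w = c` has a solution analytic at `0` whenever
`c` is analytic at `0`. -/
theorem exists_analyticAt_mul_deriv_add_eq {κ : ℂ} (hκ : 0 ≤ κ.re) {c : ℂ → ℂ}
    (hc : AnalyticAt ℂ c 0) :
    ∃ w : ℂ → ℂ, AnalyticAt ℂ w 0 ∧ ∀ᶠ t in 𝓝 (0 : ℂ), κ * t * deriv w t + w t = c t := by
  obtain ⟨p, hp⟩ := hc
  obtain ⟨ε, hε, h⟩ := Metric.eventually_nhds_iff.mp (hasFPowerSeriesAt_iff.mp hp)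
  have hden (n : ℕ) : 1 ≤ ‖1 + κ * n‖ := by
    refine le_trans ?_ (Complex.re_le_norm _)
    simpa using mul_nonneg hκ n.cast_nonneg
  have hden_ne (n : ℕ) : 1 + κ * n ≠ 0 := norm_pos_iff.mp (one_pos.trans_le (hden n))
  have hr : ‖((ε / 2 : ℝ) : ℂ)‖ = ε / 2 := Complex.norm_of_nonneg (by positivity)
  have hu : Summable fun n => (ε / 2) ^ n * ‖p.coeff n‖ := by
    have hz : dist ((ε / 2 : ℝ) : ℂ) 0 < ε := by rw [dist_zero_right, hr]; linarith
    simpa only [norm_smul, norm_pow, hr] using (h hz).summable.norm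
  set F : ℕ → ℂ → ℂ := fun n t => t ^ n * (p.coeff n / (1 + κ * n)) with hF
  have hF_diff (n : ℕ) : DifferentiableOn ℂ (F n) (Metric.ball 0 (ε / 2)) := by
    simp only [hF]; fun_prop
  have hF_le (n : ℕ) (t : ℂ) (ht : t ∈ Metric.ball 0 (ε / 2)) :
      ‖F n t‖ ≤ (ε / 2) ^ n * ‖p.coeff n‖ := by
    rw [mem_ball_zero_iff] at ht
    simp only [hF, norm_mul, norm_pow, norm_div]
    gcongr
    exact div_le_self (norm_nonneg _) (hden n)
  have hball : Metric.ball (0 : ℂ) (ε / 2) ∈ 𝓝 0 := Metric.ball_mem_nhds _ (by positivity)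
  refine ⟨fun t => ∑' n, F n t, (Complex.differentiableOn_tsum_of_summable_norm hu hF_diff
    Metric.isOpen_ball hF_le).analyticAt hball, ?_⟩
  filter_upwards [hball] with t ht
  have hd := Complex.hasSum_deriv_of_summable_norm hu hF_diff Metric.isOpen_ball hF_le ht
  have hs : HasSum (fun n => F n t) (∑' n, F n t) :=
    (Summable.of_norm_bounded hu fun n => hF_le n t ht).hasSum
  have hct : HasSum (fun n => t ^ n • p.coeff n) (c t) := by
    have htε : dist t 0 < ε := (Metric.mem_ball.mp ht).trans (by linarith)
    simpa using h htε
  have hterm (n : ℕ) : κ * t * deriv (F n) t + F n t = t ^ n • p.coeff n := by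
    have hderiv : deriv (F n) t = n * t ^ (n - 1) * (p.coeff n / (1 + κ * n)) :=
      ((hasDerivAt_pow n t).mul_const _).deriv
    have hpow : t * (n * t ^ (n - 1)) = n * t ^ n := by
      cases n with
      | zero => simp
      | succ n => simp only [Nat.add_sub_cancel]; ring
    calc κ * t * deriv (F n) t + F n t
        = (κ * (t * (n * t ^ (n - 1))) + t ^ n) * (p.coeff n / (1 + κ * n)) := by
          rw [hderiv]; simp only [hF]; ring
      _ = t ^ n * ((1 + κ * n) * (p.coeff n / (1 + κ * n))) := by rw [hpow]; ring
      _ = t ^ n • p.coeff n := by rw [mul_div_cancel₀ _ (hden_ne n), smul_eq_mul]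
  exact ((hd.mul_left (κ * t)).add hs).unique (by simpa only [hterm] using hct)

/-- For `0 ≤ re κ` the only germ of analytic solution at `0` of `κ t u' + u = 0` is zero. -/
theorem AnalyticAt.eventually_eq_zero_of_mul_deriv_add_eq_zero {κ : ℂ} (hκ : 0 ≤ κ.re) {u : ℂ → ℂ}
    (hu : AnalyticAt ℂ u 0) (h : ∀ᶠ t in 𝓝 (0 : ℂ), κ * t * deriv u t + u t = 0) :
    ∀ᶠ t in 𝓝 (0 : ℂ), u t = 0 := by
  by_contra hne
  obtain ⟨n, g, hg, hg0, hug⟩ := hu.exists_eventuallyEq_pow_smul_nonzero_iff.mpr hne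
  simp only [sub_zero, smul_eq_mul] at hug
  have key : ∀ᶠ t in 𝓝[≠] (0 : ℂ), (1 + κ * n) * g t + κ * t * deriv g t = 0 := by
    rw [eventually_nhdsWithin_iff]
    filter_upwards [h, hug, hug.eventually_nhds, hg.eventually_analyticAt] with t ht hut hut' hgt ht0
    have hderiv : deriv u t = n * t ^ (n - 1) * g t + t ^ n * deriv g t := by
      rw [EventuallyEq.deriv_eq hut']
      exact ((hasDerivAt_pow n t).mul hgt.differentiableAt.hasDerivAt).deriv
    have hpow : t * (n * t ^ (n - 1)) = n * t ^ n := by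
      cases n with
      | zero => simp
      | succ n => simp only [Nat.add_sub_cancel]; ring
    refine (mul_eq_zero.mp ?_).resolve_left (pow_ne_zero n ht0)
    rw [hderiv, hut] at ht
    linear_combination ht - κ * g t * hpow
  have hcont : ContinuousAt (fun t => (1 + κ * n) * g t + κ * t * deriv g t) 0 := by
    have := hg.continuousAt
    have := hg.deriv.continuousAt
    fun_prop
  have hlim := tendsto_nhds_unique_of_eventuallyEq
    (hcont.tendsto.mono_left nhdsWithin_le_nhds) tendsto_const_nhds key
  have hden : 1 + κ * n ≠ 0 := by
    intro h0
    have hre := congrArg Complex.re h0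
    have := mul_nonneg hκ n.cast_nonneg (α := ℝ)
    simp at hre
    linarith
  simp [hden, hg0] at hlim

/-- Analytic solvability of the singular ODE `(2/5)·t·w' + w = c` arising in the
Martinet Morse lemma: for `c` analytic near `0` with `c(0) = 1` there is a unique
analytic `w` near `0` with `w(0) = 1` solving the equation near `0`. -/
theorem singular_ode_solvable (c : ℂ → ℂ) (hc : AnalyticAt ℂ c 0) (hc0 : c 0 = 1) :
    ∃ w : ℂ → ℂ, AnalyticAt ℂ w 0 ∧ w 0 = 1 ∧
      (∀ᶠ t in 𝓝 (0 : ℂ), (2 / 5) * t * deriv w t + w t = c t) ∧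
      ∀ w' : ℂ → ℂ, AnalyticAt ℂ w' 0 → w' 0 = 1 →
        (∀ᶠ t in 𝓝 (0 : ℂ), (2 / 5) * t * deriv w' t + w' t = c t) →
        ∀ᶠ t in 𝓝 (0 : ℂ), w' t = w t := by
  have hκ : (0 : ℝ) ≤ (2 / 5 : ℂ).re := by norm_num
  obtain ⟨w, hw, hwc⟩ := exists_analyticAt_mul_deriv_add_eq hκ hc
  refine ⟨w, hw, by simpa [hc0] using hwc.self_of_nhds, hwc, fun v hv _ hvc => ?_⟩
  have h := (hv.sub hw).eventually_eq_zero_of_mul_deriv_add_eq_zero hκ (by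
    filter_upwards [hwc, hvc, hv.eventually_analyticAt, hw.eventually_analyticAt]
      with t hwt hvt hva hwa
    rw [deriv_sub hva.differentiableAt hwa.differentiableAt, Pi.sub_apply]
    linear_combination hvt - hwt)
  filter_upwards [h] with t ht using sub_eq_zero.mp ht
end

section
/- Derivative of the magnetic flux through the vanishing half-cycle (Section 4.1 of the paper): let c be a real-analytic function of one variable near 0 ∈ ℝ, and for small t > 0 define V(t) = ∬_{D(t)} x·c(x + y²) dx dy, where D(t) = {(x,y) ∈ ℝ² : x ≥ 0, x + y² ≤ t} is the region bounded by the vanishing half-cycle of the boundary singularity (x + y², {x=0}). Then V is differentiable on an interval (0, ε) and V'(t) = (4/3)·t^{3/2}·c(t); consequently the functional invariant c is recovered from the flux by c(t) = (3/4)·t^{−3/2}·V'(t), and in particular for c ≡ 1 the flux of the standard Martinet form is V₀(t) = (4/3)·t^{5/2}·(2/5)·... i.e. V₀(t) = (8/15)·t^{5/2} with V₀'(t) = (4/3)·t^{3/2}·... specifically: for c ≡ 1, V(t) = (8/15)·t^{5/2} for all small t > 0. -/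
open Filter Topology MeasureTheory

theorem isClosed_setOf_le_and_le {X : Type*} [TopologicalSpace X] {f g h k : X → ℝ}
    (hf : Continuous f) (hg : Continuous g) (hh : Continuous h) (hk : Continuous k) :
    IsClosed {x | f x ≤ g x ∧ h x ≤ k x} :=
  (isClosed_le hf hg).inter (isClosed_le hh hk)

theorem integral_sub_sq_Icc_sqrt {s : ℝ} (hs : 0 ≤ s) :
    ∫ y in Set.Icc (-√s) √s, (s - y ^ 2) = 4 / 3 * s ^ ((3 : ℝ) / 2) := by
  have h32 : s ^ ((3 : ℝ) / 2) = s * √s := by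
    rw [Real.sqrt_eq_rpow, show (3 : ℝ) / 2 = 1 + 1 / 2 by norm_num,
      Real.rpow_add' hs (by norm_num), Real.rpow_one]
  have hle : -√s ≤ √s := by linarith [Real.sqrt_nonneg s]
  have hint (f : ℝ → ℝ) (hf : Continuous f) : IntervalIntegrable f volume (-√s) √s :=
    hf.intervalIntegrable _ _
  rw [integral_Icc_eq_integral_Ioc, ← intervalIntegral.integral_of_le hle,
    intervalIntegral.integral_sub (hint _ continuous_const) (hint _ (by fun_prop)),
    intervalIntegral.integral_const, integral_pow, h32, smul_eq_mul]
  have h3 : √s ^ 3 = s * √s := by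
    rw [pow_succ, Real.sq_sqrt hs]
  norm_num
  linear_combination (-2 / 3 : ℝ) * h3

/-- Integrals over the region `0 ≤ x`, `x + y ^ 2 ≤ t` reduce to integrals over the levels of
`x + y ^ 2`. -/
theorem setIntegral_mul_comp_add_sq {c : ℝ → ℝ} (hc : Continuous c) {t : ℝ} (ht : 0 ≤ t) :
    ∫ p in {p : ℝ × ℝ | 0 ≤ p.1 ∧ p.1 + p.2 ^ 2 ≤ t}, p.1 * c (p.1 + p.2 ^ 2) =
      ∫ s in (0 : ℝ)..t, 4 / 3 * s ^ ((3 : ℝ) / 2) * c s := by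
  set D : Set (ℝ × ℝ) := {p | 0 ≤ p.1 ∧ p.1 + p.2 ^ 2 ≤ t} with hD
  set E : Set (ℝ × ℝ) := {p | p.1 ^ 2 ≤ p.2 ∧ p.2 ≤ t} with hE
  have hDclosed : IsClosed D :=
    isClosed_setOf_le_and_le (by fun_prop) (by fun_prop) (by fun_prop) (by fun_prop)
  have hEclosed : IsClosed E :=
    isClosed_setOf_le_and_le (by fun_prop) (by fun_prop) (by fun_prop) (by fun_prop)
  have hDcompact : IsCompact D := by
    refine (isCompact_Icc (a := ((0 : ℝ), -√t)) (b := (t, √t))).of_isClosed_subset hDclosed ?_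
    rintro ⟨x, y⟩ ⟨h0, h1⟩
    have hy := Real.abs_le_sqrt (show y ^ 2 ≤ t by simp only at h0 h1; linarith)
    exact ⟨⟨h0, (abs_le.1 hy).1⟩, ⟨by simp only at h1 ⊢; nlinarith, (abs_le.1 hy).2⟩⟩
  have hEcompact : IsCompact E := by
    refine (isCompact_Icc (a := (-√t, (0 : ℝ))) (b := (√t, t))).of_isClosed_subset hEclosed ?_
    rintro ⟨y, s⟩ ⟨h0, h1⟩
    have hy := Real.abs_le_sqrt (show y ^ 2 ≤ t from h0.trans h1)
    exact ⟨⟨(abs_le.1 hy).1, (sq_nonneg y).trans h0⟩, ⟨(abs_le.1 hy).2, h1⟩⟩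
  set F : ℝ × ℝ → ℝ := D.indicator fun p => p.1 * c (p.1 + p.2 ^ 2) with hF
  set G : ℝ × ℝ → ℝ := E.indicator fun p => (p.2 - p.1 ^ 2) * c p.2 with hG
  have hFint : Integrable F :=
    (ContinuousOn.integrableOn_compact hDcompact (by fun_prop)).integrable_indicator
      hDclosed.measurableSet
  have hGint : Integrable G :=
    (ContinuousOn.integrableOn_compact hEcompact (by fun_prop)).integrable_indicator
      hEclosed.measurableSet
  have hFG (x y : ℝ) : F (x, y) = G (y, x + y ^ 2) := by
    simp [hF, hG, hD, hE, Set.indicator_apply]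
  have hslice (s : ℝ) : ∫ y, G (y, s) =
      (Set.Icc 0 t).indicator (fun s => 4 / 3 * s ^ ((3 : ℝ) / 2) * c s) s := by
    by_cases hs : s ∈ Set.Icc 0 t
    · have hGs (y : ℝ) : G (y, s) =
          (Set.Icc (-√s) √s).indicator (fun y => (s - y ^ 2) * c s) y := by
        have : (y, s) ∈ E ↔ y ∈ Set.Icc (-√s) √s := by
          simp [hE, hs.2, Real.sq_le hs.1]
        simp only [hG, Set.indicator_apply, this]
      simp_rw [hGs]
      rw [integral_indicator measurableSet_Icc, integral_mul_const,
        integral_sub_sq_Icc_sqrt hs.1, Set.indicator_of_mem hs]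
    · have hGs (y : ℝ) : G (y, s) = 0 :=
        Set.indicator_of_notMem (fun h => hs ⟨(sq_nonneg y).trans h.1, h.2⟩) _
      simp [hGs, Set.indicator_of_notMem hs]
  calc ∫ p in D, p.1 * c (p.1 + p.2 ^ 2)
      = ∫ p, F p := (integral_indicator hDclosed.measurableSet).symm
    _ = ∫ y, ∫ x, F (x, y) := integral_prod_symm F hFint
    _ = ∫ y, ∫ s, G (y, s) := by
        simp_rw [hFG]
        congr 1 with y
        exact integral_add_right_eq_self (fun s => G (y, s)) (y ^ 2)
    _ = ∫ s, ∫ y, G (y, s) := integral_integral_swap (f := fun y s => G (y, s)) hGint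
    _ = _ := by
        simp_rw [hslice]
        rw [integral_indicator measurableSet_Icc, integral_Icc_eq_integral_Ioc,
          intervalIntegral.integral_of_le ht]

/-- Derivative of the magnetic flux through the vanishing half-cycle (Section 4.1):
for `V(t) = ∬_{D(t)} x·c(x+y²) dx dy` over `D(t) = {x ≥ 0, x + y² ≤ t}`, one has
`V'(t) = (4/3) t^{3/2} c(t)` for small `t > 0`, hence `c(t) = (3/4) t^{-3/2} V'(t)`,
and for `c ≡ 1` the flux is `V(t) = (8/15) t^{5/2}`. -/
theorem flux_derivative (c : ℝ → ℝ) (hc : AnalyticAt ℝ c 0)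
    (V : ℝ → ℝ)
    (hV : ∀ t : ℝ, V t =
      ∫ p in {p : ℝ × ℝ | 0 ≤ p.1 ∧ p.1 + p.2 ^ 2 ≤ t}, p.1 * c (p.1 + p.2 ^ 2)) :
    ∃ ε > (0 : ℝ), ∀ t ∈ Set.Ioo (0 : ℝ) ε,
      HasDerivAt V ((4 / 3) * t ^ ((3 : ℝ) / 2) * c t) t ∧
      c t = (3 / 4) * t ^ (-(3 : ℝ) / 2) * deriv V t ∧
      ((∀ s, c s = 1) → V t = (8 / 15) * t ^ ((5 : ℝ) / 2)) := by
  obtain ⟨r, hr, hball⟩ := Metric.eventually_nhds_iff.1 hc.eventually_analyticAt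
  have hε : 0 < r / 2 := by positivity
  -- `c` need not be continuous away from `0`, so work with a globally continuous truncation.
  set b : ℝ → ℝ := fun s => c (max 0 (min s (r / 2))) with hb
  have hbcont : Continuous b := by
    refine continuous_iff_continuousAt.2 fun s => ?_
    have h0 : 0 ≤ max 0 (min s (r / 2)) := le_max_left _ _
    have h1 : max 0 (min s (r / 2)) ≤ r / 2 := max_le hε.le (min_le_right _ _)
    have hcs : ContinuousAt c (max 0 (min s (r / 2))) :=
      (hball (by rw [Real.dist_eq, sub_zero, abs_of_nonneg h0]; linarith)).continuousAt
    exact ContinuousAt.comp (f := fun s => max 0 (min s (r / 2))) hcs (by fun_prop)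
  have hbc {s : ℝ} (h0 : 0 ≤ s) (h1 : s ≤ r / 2) : b s = c s := by
    simp [hb, h0, h1]
  have hVb {t : ℝ} (ht : t ∈ Set.Ioo 0 (r / 2)) :
      V t = ∫ s in (0 : ℝ)..t, 4 / 3 * s ^ ((3 : ℝ) / 2) * b s := by
    rw [hV, ← setIntegral_mul_comp_add_sq hbcont ht.1.le]
    refine setIntegral_congr_fun (isClosed_setOf_le_and_le (by fun_prop) (by fun_prop)
      (by fun_prop) (by fun_prop)).measurableSet fun p hp => ?_
    rw [hbc (add_nonneg hp.1 (sq_nonneg _)) (hp.2.trans ht.2.le)]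
  have hcont : Continuous fun s : ℝ => 4 / 3 * s ^ ((3 : ℝ) / 2) * b s :=
    (continuous_const.mul (Real.continuous_rpow_const (by norm_num))).mul hbcont
  refine ⟨r / 2, hε, fun t ht => ?_⟩
  have hderiv : HasDerivAt V ((4 / 3) * t ^ ((3 : ℝ) / 2) * c t) t := by
    rw [← hbc ht.1.le ht.2.le]
    refine (hcont.integral_hasStrictDerivAt 0 t).hasDerivAt.congr_of_eventuallyEq ?_
    filter_upwards [isOpen_Ioo.mem_nhds ht] with u hu using hVb hu
  refine ⟨hderiv, ?_, fun hone => ?_⟩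
  · have hpow : t ^ (-(3 : ℝ) / 2) * t ^ ((3 : ℝ) / 2) = 1 := by
      rw [← Real.rpow_add ht.1]; norm_num
    rw [hderiv.deriv]
    linear_combination (-c t) * hpow
  · rw [hVb ht]
    simp only [hb, hone, mul_one]
    rw [intervalIntegral.integral_const_mul, integral_rpow (Or.inl (by norm_num)),
      show (3 : ℝ) / 2 + 1 = 5 / 2 by norm_num, Real.zero_rpow (by norm_num)]
    ring
end
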